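/- Let H₁ = H₂ = ℂ² with orthonormal bases (e₁,e₂), (f₁,f₂), let 0 ≤ λ ≤ 1, φ(λ) = λ·e₁⊗f₁ + √(1−λ²)·e₂⊗f₂, C(λ) = Conv(K·P_{φ(λ)}), ρ₀ = (1/2)(P_{e₁}⊗P_{f₁} + P_{e₂}⊗P_{f₂}), and C₀ = Conv(K·ρ₀). Suppose R > 0 is such that 𝕀_H + A ∈ C(λ) whenever A is traceless Hermitian with ‖A‖ ≤ R, and r₀ > 0 is such that 𝕀_H + B ∈ C₀ whenever B ∈ su*(H₁)⊗su*(H₂) with ‖B‖ ≤ r₀. Then for any ρ¹⁰ ∈ 𝕀₁⊗su*(H₂), ρ⁰¹ ∈ su*(H₁)⊗𝕀₂, and ρ⁰⁰ ∈ su*(H₁)⊗su*(H₂) satisfying ‖ρ¹⁰‖²/R² + ‖ρ⁰¹‖²/R² + ‖ρ⁰⁰‖²/r₀² ≤ 1/4, the operator 𝕀_H + ρ¹⁰ + ρ⁰¹ + ρ⁰⁰ belongs to C(λ); i.e., the ellipsoid E(λ) with semi-axes R/2, R/2, r₀/2 along these three orthogonal subspaces is contained in C(λ). -/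

import Mathlib

open Matrix
open scoped Kronecker

noncomputable section

/-- The pure state (rank-one projection) `|ψ⟩⟨ψ|` associated with a vector `ψ`. -/
def pureState {n : Type*} [Fintype n] (ψ : n → ℂ) : Matrix n n ℂ :=
  Matrix.vecMulVec ψ (star ψ)

/-- A family of vectors is an orthonormal system. -/
def ONFamily {ι n : Type*} [DecidableEq ι] [Fintype n] (v : ι → n → ℂ) : Prop :=
  ∀ i j, (∑ p, (starRingEnd ℂ) (v i p) * v j p) = if i = j then 1 else 0

/-- The Hilbert–Schmidt norm `‖A‖ = √tr(A²)` (of a Hermitian matrix `A`). -/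
def hsNorm {n : Type*} [Fintype n] (A : Matrix n n ℂ) : ℝ :=
  Real.sqrt ((A * A).trace.re)

/-- The orbit of an operator `A` on `H₁ ⊗ H₂` under the local unitary group
`K = U(H₁) × U(H₂)` acting by `(U₁,U₂)·A = (U₁ ⊗ U₂) A (U₁ ⊗ U₂)†`. -/
def localOrbit (d₁ d₂ : ℕ) (A : Matrix (Fin d₁ × Fin d₂) (Fin d₁ × Fin d₂) ℂ) :
    Set (Matrix (Fin d₁ × Fin d₂) (Fin d₁ × Fin d₂) ℂ) :=
  {B | ∃ U₁ ∈ Matrix.unitaryGroup (Fin d₁) ℂ, ∃ U₂ ∈ Matrix.unitaryGroup (Fin d₂) ℂ,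
    B = (U₁ ⊗ₖ U₂) * A * (U₁ ⊗ₖ U₂)ᴴ}

/-- The two-qubit vector `φ(λ) = λ·e₁⊗f₁ + √(1−λ²)·e₂⊗f₂`. -/
def phiVec (e f : Fin 2 → Fin 2 → ℂ) (lam : ℝ) : Fin 2 × Fin 2 → ℂ :=
  fun p => (lam : ℂ) * e 0 p.1 * f 0 p.2 +
    ((Real.sqrt (1 - lam ^ 2) : ℝ) : ℂ) * e 1 p.1 * f 1 p.2

/-- The state `ρ₀ = ½ (P_{e₁}⊗P_{f₁} + P_{e₂}⊗P_{f₂})`. -/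
def rho0 (e f : Fin 2 → Fin 2 → ℂ) : Matrix (Fin 2 × Fin 2) (Fin 2 × Fin 2) ℂ :=
  (2 : ℂ)⁻¹ • (pureState (e 0) ⊗ₖ pureState (f 0) + pureState (e 1) ⊗ₖ pureState (f 1))

/-- The set of traceless Hermitian matrices (`su*(H)`). -/
def suSet (n : Type*) [Fintype n] [DecidableEq n] : Set (Matrix n n ℂ) :=
  {A | A.IsHermitian ∧ A.trace = 0}

/-- The real subspace `su*(H₁) ⊗ su*(H₂)` of Hermitian operators on `H₁ ⊗ H₂`. -/
def suKronSu (d₁ d₂ : ℕ) : Submodule ℝ (Matrix (Fin d₁ × Fin d₂) (Fin d₁ × Fin d₂) ℂ) :=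
  Submodule.span ℝ
    {M | ∃ A ∈ suSet (Fin d₁), ∃ B ∈ suSet (Fin d₂), M = A ⊗ₖ B}

theorem conj_pureState {m n : Type*} [Fintype m] [Fintype n] (M : Matrix m n ℂ) (ψ : n → ℂ) :
    M * pureState ψ * Mᴴ = pureState (M *ᵥ ψ) := by
  rw [pureState, pureState, mul_vecMulVec, vecMulVec_mul, star_mulVec]

theorem kronecker_mulVec_phiVec (U V : Matrix (Fin 2) (Fin 2) ℂ) (e f : Fin 2 → Fin 2 → ℂ)
    (lam : ℝ) :
    (U ⊗ₖ V) *ᵥ phiVec e f lam = phiVec (fun i => U *ᵥ e i) (fun i => V *ᵥ f i) lam := by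
  funext p
  simp only [mulVec, dotProduct, Fintype.sum_prod_type, Fin.sum_univ_two, phiVec,
    kroneckerMap_apply]
  ring

theorem conj_rho0 (U V : Matrix (Fin 2) (Fin 2) ℂ) (e f : Fin 2 → Fin 2 → ℂ) :
    (U ⊗ₖ V) * rho0 e f * (U ⊗ₖ V)ᴴ = rho0 (fun i => U *ᵥ e i) (fun i => V *ᵥ f i) := by
  simp only [rho0, conjTranspose_kronecker, mul_smul_comm, smul_mul_assoc, mul_add, add_mul,
    ← mul_kronecker_mul, conj_pureState]

/-- The matrix whose columns are the vectors of a family. -/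
def columnMatrix (e : Fin 2 → Fin 2 → ℂ) : Matrix (Fin 2) (Fin 2) ℂ :=
  (Matrix.of e)ᵀ

theorem onFamily_iff_columnMatrix {e : Fin 2 → Fin 2 → ℂ} :
    ONFamily e ↔ columnMatrix e ∈ unitaryGroup (Fin 2) ℂ := by
  rw [mem_unitaryGroup_iff', ← Matrix.ext_iff]
  simp only [ONFamily, star_eq_conjTranspose, mul_apply, conjTranspose_apply, columnMatrix,
    transpose_apply, of_apply, one_apply, starRingEnd_apply]

theorem columnMatrix_mulVec (U : Matrix (Fin 2) (Fin 2) ℂ) (e : Fin 2 → Fin 2 → ℂ) :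
    columnMatrix (fun i => U *ᵥ e i) = U * columnMatrix e := by
  ext i j
  simp only [columnMatrix, mul_apply, mulVec, dotProduct, transpose_apply, of_apply]

theorem ONFamily.mulVec {e : Fin 2 → Fin 2 → ℂ} (he : ONFamily e)
    {U : Matrix (Fin 2) (Fin 2) ℂ} (hU : U ∈ unitaryGroup (Fin 2) ℂ) :
    ONFamily (fun i => U *ᵥ e i) := by
  rw [onFamily_iff_columnMatrix, columnMatrix_mulVec]
  exact mul_mem hU (onFamily_iff_columnMatrix.1 he)

theorem ONFamily.exists_unitary {e e' : Fin 2 → Fin 2 → ℂ} (he : ONFamily e)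
    (he' : ONFamily e') : ∃ U ∈ unitaryGroup (Fin 2) ℂ, (fun i => U *ᵥ e i) = e' := by
  rw [onFamily_iff_columnMatrix] at he he'
  refine ⟨columnMatrix e' * star (columnMatrix e), mul_mem he' (Unitary.star_mem he), ?_⟩
  have h : columnMatrix (fun i => (columnMatrix e' * star (columnMatrix e)) *ᵥ e i) =
      columnMatrix e' := by
    rw [columnMatrix_mulVec, mul_assoc, mem_unitaryGroup_iff'.1 he, mul_one]
  exact Matrix.of.injective (transpose_injective h)

theorem ONFamily.swap {e : Fin 2 → Fin 2 → ℂ} (he : ONFamily e) : ONFamily ![e 1, e 0] := by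
  have h := he
  simp only [ONFamily, Fin.forall_fin_two] at h ⊢
  simp_all

theorem ONFamily.neg_right {e : Fin 2 → Fin 2 → ℂ} (he : ONFamily e) :
    ONFamily ![e 0, -e 1] := by
  have h := he
  simp only [ONFamily, Fin.forall_fin_two, Fin.sum_univ_two] at h ⊢
  obtain ⟨⟨h1, h2⟩, h3, h4⟩ := h
  refine ⟨⟨?_, ?_⟩, ?_, ?_⟩ <;> simp at h1 h2 h3 h4 ⊢
  · exact h1
  · linear_combination -h2
  · linear_combination -h3
  · exact h4

theorem pureState_phiVec_mem_localOrbit {e f e' f' : Fin 2 → Fin 2 → ℂ} (he : ONFamily e)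
    (hf : ONFamily f) (he' : ONFamily e') (hf' : ONFamily f') (lam : ℝ) :
    pureState (phiVec e' f' lam) ∈ localOrbit 2 2 (pureState (phiVec e f lam)) := by
  obtain ⟨U, hU, rfl⟩ := he.exists_unitary he'
  obtain ⟨V, hV, rfl⟩ := hf.exists_unitary hf'
  exact ⟨U, hU, V, hV, by rw [conj_pureState, kronecker_mulVec_phiVec]⟩

/-- Averaging over a relative sign and over the exchange of the two basis vectors turns the pure
state of `φ(λ)` into `ρ₀`. -/
theorem rho0_eq_average (e f : Fin 2 → Fin 2 → ℂ) {lam : ℝ} (h0 : 0 ≤ lam) (h1 : lam ≤ 1) :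
    rho0 e f =
      (2⁻¹ : ℝ) • ((2⁻¹ : ℝ) • pureState (phiVec e f lam) +
        (2⁻¹ : ℝ) • pureState (phiVec ![e 0, -e 1] f lam)) +
      (2⁻¹ : ℝ) • ((2⁻¹ : ℝ) • pureState (phiVec ![e 1, e 0] ![f 1, f 0] lam) +
        (2⁻¹ : ℝ) • pureState (phiVec ![e 1, -e 0] ![f 1, f 0] lam)) := by
  have hs : ((Real.sqrt (1 - lam ^ 2) : ℝ) : ℂ) ^ 2 = 1 - (lam : ℂ) ^ 2 := by
    rw [← Complex.ofReal_pow, Real.sq_sqrt (by nlinarith)]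
    push_cast
    rfl
  ext p q
  simp only [rho0, pureState, phiVec, vecMulVec_apply, kroneckerMap_apply, Matrix.smul_apply,
    Matrix.add_apply, Pi.star_apply, Pi.neg_apply, Complex.real_smul, smul_eq_mul, star_add,
    star_mul, star_neg, Complex.star_def, Complex.conj_ofReal, cons_val_zero, cons_val_one,
    Complex.ofReal_inv, Complex.ofReal_ofNat]
  linear_combination (-(1 / 2) * (e 0 p.1 * (starRingEnd ℂ) (e 0 q.1) * f 0 p.2 *
      (starRingEnd ℂ) (f 0 q.2) + e 1 p.1 * (starRingEnd ℂ) (e 1 q.1) * f 1 p.2 *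
      (starRingEnd ℂ) (f 1 q.2))) * hs

theorem rho0_mem_convexHull {e f e' f' : Fin 2 → Fin 2 → ℂ} (he : ONFamily e)
    (hf : ONFamily f) (he' : ONFamily e') (hf' : ONFamily f') {lam : ℝ} (h0 : 0 ≤ lam)
    (h1 : lam ≤ 1) :
    rho0 e' f' ∈ convexHull ℝ (localOrbit 2 2 (pureState (phiVec e f lam))) := by
  have hc := convex_convexHull ℝ (localOrbit 2 2 (pureState (phiVec e f lam)))
  have hmem {a b : Fin 2 → Fin 2 → ℂ} (ha : ONFamily a) (hb : ONFamily b) :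
      pureState (phiVec a b lam) ∈
        convexHull ℝ (localOrbit 2 2 (pureState (phiVec e f lam))) :=
    subset_convexHull ℝ _ (pureState_phiVec_mem_localOrbit he hf ha hb lam)
  rw [rho0_eq_average e' f' h0 h1]
  exact hc
    (hc (hmem he' hf') (hmem he'.neg_right hf') (by norm_num) (by norm_num) (by norm_num))
    (hc (hmem he'.swap hf'.swap) (hmem he'.swap.neg_right hf'.swap) (by norm_num) (by norm_num)
      (by norm_num))
    (by norm_num) (by norm_num) (by norm_num)

/-- The orbit hull of `ρ₀` lies in the orbit hull of the pure state of `φ(λ)`. -/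
theorem convexHull_localOrbit_rho0_subset {e f : Fin 2 → Fin 2 → ℂ} (he : ONFamily e)
    (hf : ONFamily f) {lam : ℝ} (h0 : 0 ≤ lam) (h1 : lam ≤ 1) :
    convexHull ℝ (localOrbit 2 2 (rho0 e f)) ⊆
      convexHull ℝ (localOrbit 2 2 (pureState (phiVec e f lam))) := by
  refine convexHull_min ?_ (convex_convexHull ℝ _)
  rintro _ ⟨U, hU, V, hV, rfl⟩
  rw [conj_rho0]
  exact rho0_mem_convexHull he hf (he.mulVec hU) (hf.mulVec hV) h0 h1

theorem hsNorm_smul {n : Type*} [Fintype n] {c : ℝ} (hc : 0 ≤ c) (A : Matrix n n ℂ) :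
    hsNorm (c • A) = c * hsNorm A := by
  rw [hsNorm, hsNorm, smul_mul_smul_comm, trace_smul, Complex.smul_re, smul_eq_mul,
    Real.sqrt_mul (mul_self_nonneg c), Real.sqrt_mul_self hc]

open scoped ComplexOrder in
theorem hsNorm_sq {n : Type*} [Fintype n] {A : Matrix n n ℂ} (hA : A.IsHermitian) :
    hsNorm A ^ 2 = (A * A).trace.re := by
  refine Real.sq_sqrt ?_
  have h := (posSemidef_conjTranspose_mul_self A).trace_nonneg
  rw [hA.eq] at h
  exact (Complex.le_def.1 h).1

theorem hsNorm_add_sq {n : Type*} [Fintype n] {A B : Matrix n n ℂ} (hA : A.IsHermitian)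
    (hB : B.IsHermitian) (hAB : (A * B).trace = 0) :
    hsNorm (A + B) ^ 2 = hsNorm A ^ 2 + hsNorm B ^ 2 := by
  rw [hsNorm_sq (hA.add hB), hsNorm_sq hA, hsNorm_sq hB, add_mul, mul_add, mul_add, trace_add,
    trace_add, trace_add, trace_mul_comm B A, hAB]
  simp

/-- two-qubit system, `0 ≤ λ ≤ 1`, `C(λ) = Conv(K·P_{φ(λ)})`,
`C₀ = Conv(K·ρ₀)`.  If the ball of radius `R > 0` of traceless Hermitian operators around
`𝕀_H` lies in `C(λ)`, and the ball of radius `r₀ > 0` of `su*(H₁)⊗su*(H₂)` operators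
around `𝕀_H` lies in `C₀`, then for `ρ¹⁰ ∈ 𝕀₁⊗su*(H₂)`, `ρ⁰¹ ∈ su*(H₁)⊗𝕀₂` and
`ρ⁰⁰ ∈ su*(H₁)⊗su*(H₂)` with `‖ρ¹⁰‖²/R² + ‖ρ⁰¹‖²/R² + ‖ρ⁰⁰‖²/r₀² ≤ 1/4`, the operator
`𝕀_H + ρ¹⁰ + ρ⁰¹ + ρ⁰⁰` belongs to `C(λ)`; i.e. the ellipsoid `E(λ)` with semi-axes
`R/2, R/2, r₀/2` along these three orthogonal subspaces is contained in `C(λ)`. -/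
theorem stmt14 (e f : Fin 2 → Fin 2 → ℂ) (he : ONFamily e) (hf : ONFamily f)
    (lam : ℝ) (hlam0 : 0 ≤ lam) (hlam1 : lam ≤ 1)
    (R r₀ : ℝ) (hR : 0 < R) (hr₀ : 0 < r₀)
    (hRball : ∀ A : Matrix (Fin 2 × Fin 2) (Fin 2 × Fin 2) ℂ,
      A.IsHermitian → A.trace = 0 → hsNorm A ≤ R →
      (4 : ℂ)⁻¹ • 1 + A ∈ convexHull ℝ (localOrbit 2 2 (pureState (phiVec e f lam))))
    (hr₀ball : ∀ B ∈ suKronSu 2 2, hsNorm B ≤ r₀ →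
      (4 : ℂ)⁻¹ • 1 + B ∈ convexHull ℝ (localOrbit 2 2 (rho0 e f)))
    (ρ10 ρ01 ρ00 : Matrix (Fin 2 × Fin 2) (Fin 2 × Fin 2) ℂ)
    (h10 : ∃ B ∈ suSet (Fin 2), ρ10 = ((2 : ℂ)⁻¹ • 1) ⊗ₖ B)
    (h01 : ∃ A ∈ suSet (Fin 2), ρ01 = A ⊗ₖ ((2 : ℂ)⁻¹ • 1))
    (h00 : ρ00 ∈ suKronSu 2 2)
    (hell : hsNorm ρ10 ^ 2 / R ^ 2 + hsNorm ρ01 ^ 2 / R ^ 2 + hsNorm ρ00 ^ 2 / r₀ ^ 2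
      ≤ 1 / 4) :
    (4 : ℂ)⁻¹ • 1 + ρ10 + ρ01 + ρ00 ∈
      convexHull ℝ (localOrbit 2 2 (pureState (phiVec e f lam))) := by
  obtain ⟨B, ⟨hB, hBt⟩, rfl⟩ := h10
  obtain ⟨A, ⟨hA, hAt⟩, rfl⟩ := h01
  have hI : ((2 : ℂ)⁻¹ • (1 : Matrix (Fin 2) (Fin 2) ℂ)).IsHermitian := by
    simp [IsHermitian, conjTranspose_smul]
  have hX : (((2 : ℂ)⁻¹ • (1 : Matrix (Fin 2) (Fin 2) ℂ)) ⊗ₖ B).IsHermitian := by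
    rw [IsHermitian, conjTranspose_kronecker, hI.eq, hB.eq]
  have hY : (A ⊗ₖ ((2 : ℂ)⁻¹ • (1 : Matrix (Fin 2) (Fin 2) ℂ))).IsHermitian := by
    rw [IsHermitian, conjTranspose_kronecker, hI.eq, hA.eq]
  have hXt : (((2 : ℂ)⁻¹ • (1 : Matrix (Fin 2) (Fin 2) ℂ)) ⊗ₖ B).trace = 0 := by
    rw [trace_kronecker, hBt, mul_zero]
  have hYt : (A ⊗ₖ ((2 : ℂ)⁻¹ • (1 : Matrix (Fin 2) (Fin 2) ℂ))).trace = 0 := by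
    rw [trace_kronecker, hAt, zero_mul]
  have hXY : (((2 : ℂ)⁻¹ • (1 : Matrix (Fin 2) (Fin 2) ℂ)) ⊗ₖ B *
      A ⊗ₖ ((2 : ℂ)⁻¹ • (1 : Matrix (Fin 2) (Fin 2) ℂ))).trace = 0 := by
    rw [← mul_kronecker_mul, trace_kronecker, smul_mul_assoc, one_mul, trace_smul, hAt, smul_zero,
      zero_mul]
  generalize ((2 : ℂ)⁻¹ • (1 : Matrix (Fin 2) (Fin 2) ℂ)) ⊗ₖ B = X at *
  generalize A ⊗ₖ ((2 : ℂ)⁻¹ • (1 : Matrix (Fin 2) (Fin 2) ℂ)) = Y at *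
  have hlocal : hsNorm ((2 : ℝ) • (X + Y)) ≤ R := by
    rw [hsNorm_smul zero_le_two]
    refine abs_le_of_sq_le_sq' ?_ hR.le |>.2
    have h : (hsNorm X ^ 2 + hsNorm Y ^ 2) / R ^ 2 ≤ 1 / 4 := by
      rw [add_div]
      linarith [show 0 ≤ hsNorm ρ00 ^ 2 / r₀ ^ 2 by positivity]
    rw [div_le_iff₀ (by positivity)] at h
    rw [mul_pow, hsNorm_add_sq hX hY hXY]
    linarith
  have hcorr : hsNorm ((2 : ℝ) • ρ00) ≤ r₀ := by
    rw [hsNorm_smul zero_le_two]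
    refine abs_le_of_sq_le_sq' ?_ hr₀.le |>.2
    have h : hsNorm ρ00 ^ 2 / r₀ ^ 2 ≤ 1 / 4 := by
      linarith [show 0 ≤ hsNorm X ^ 2 / R ^ 2 by positivity,
        show 0 ≤ hsNorm Y ^ 2 / R ^ 2 by positivity]
    rw [div_le_iff₀ (by positivity)] at h
    rw [mul_pow]
    linarith
  have hleft := hRball ((2 : ℝ) • (X + Y))
    ((hX.add hY).smul (IsSelfAdjoint.all (2 : ℝ)))
    (by rw [trace_smul, trace_add, hXt, hYt, add_zero, smul_zero]) hlocal
  have hright := convexHull_localOrbit_rho0_subset he hf hlam0 hlam1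
    (hr₀ball ((2 : ℝ) • ρ00) (Submodule.smul_mem _ _ h00) hcorr)
  convert convex_convexHull ℝ _ hleft hright (a := 2⁻¹) (b := 2⁻¹) (by norm_num) (by norm_num)
    (by norm_num) using 1
  module

end
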